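/- In the two-user MAC JSCC setup, suppose A₁ ⊆ S₁, δ₁ ≥ 0, and reals R₁, γ, k₁ satisfy: for every ŝ₁ ∈ Ŝ₁, P(S₁ ∈ A₁ and d₁(S₁, ŝ₁) ≤ δ₁) ≤ 2^{−n(R₁ + k₁)}. Then P({i₁(S₁,S₂,Y) ≤ R₁ − γ} ∩ {d₁(S₁, g₁(Y)) ≤ δ₁} ∩ {S₁ ∈ A₁}) ≤ 2^{−n(γ + k₁)}. -/

import Mathlib

open scoped BigOperators

/-- Probability of an event under a PMF on a finite type. -/
noncomputable def srcPr {S : Type*} [Fintype S] (p : PMF S) (E : Set S) : ℝ :=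
  ∑ s, E.indicator (fun s => (p s).toReal) s

/-- Probability of an event for the joint law
`P(s₁, s₂, y) = p₁(s₁) · p₂(s₂) · W(e₁(s₁), e₂(s₂))(y)` of the two independent
sources and the output of the multiple-access channel. -/
noncomputable def macPr {S₁ S₂ X₁ X₂ Y : Type*} [Fintype S₁] [Fintype S₂] [Fintype Y]
    (p₁ : PMF S₁) (p₂ : PMF S₂) (W : X₁ → X₂ → PMF Y)
    (e₁ : S₁ → X₁) (e₂ : S₂ → X₂) (E : Set (S₁ × S₂ × Y)) : ℝ :=
  ∑ s₁, ∑ s₂, ∑ y,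
    E.indicator
      (fun z => (p₁ z.1 * p₂ z.2.1 * W (e₁ z.1) (e₂ z.2.1) z.2.2).toReal) (s₁, s₂, y)

/-- Conditional output law `q₁(y | s₂) = ∑ s₁, p₁(s₁) · W(e₁(s₁), e₂(s₂))(y)`. -/
noncomputable def macQ₁ {S₁ S₂ X₁ X₂ Y : Type*} [Fintype S₁]
    (p₁ : PMF S₁) (W : X₁ → X₂ → PMF Y) (e₁ : S₁ → X₁) (e₂ : S₂ → X₂)
    (s₂ : S₂) (y : Y) : ℝ :=
  ∑ s₁, (p₁ s₁ * W (e₁ s₁) (e₂ s₂) y).toReal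

/-- Conditional information density
`i₁(s₁, s₂, y) = (1/n) log₂ (W(e₁(s₁), e₂(s₂))(y) / q₁(y|s₂))`. -/
noncomputable def macInfo₁ {S₁ S₂ X₁ X₂ Y : Type*} [Fintype S₁]
    (n : ℕ) (p₁ : PMF S₁) (W : X₁ → X₂ → PMF Y) (e₁ : S₁ → X₁) (e₂ : S₂ → X₂)
    (s₁ : S₁) (s₂ : S₂) (y : Y) : ℝ :=
  (1 / (n : ℝ)) *
    Real.logb 2 ((W (e₁ s₁) (e₂ s₂) y).toReal / macQ₁ p₁ W e₁ e₂ s₂ y)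

theorem PMF.sum_toReal_eq_one {α : Type*} [Fintype α] (p : PMF α) : ∑ a, (p a).toReal = 1 := by
  rw [← ENNReal.toReal_sum fun a _ => p.apply_ne_top a, ← tsum_fintype (L := .unconditional α),
    p.tsum_coe, ENNReal.toReal_one]

section

variable {S₁ S₂ X₁ X₂ Y : Type*} [Fintype S₁]
  (p₁ : PMF S₁) (W : X₁ → X₂ → PMF Y) (e₁ : S₁ → X₁) (e₂ : S₂ → X₂)

theorem macQ₁_nonneg (s₂ : S₂) (y : Y) : 0 ≤ macQ₁ p₁ W e₁ e₂ s₂ y :=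
  Finset.sum_nonneg fun _ _ => ENNReal.toReal_nonneg

theorem mul_toReal_le_macQ₁ (s₁ : S₁) (s₂ : S₂) (y : Y) :
    (p₁ s₁).toReal * (W (e₁ s₁) (e₂ s₂) y).toReal ≤ macQ₁ p₁ W e₁ e₂ s₂ y := by
  rw [← ENNReal.toReal_mul]
  exact Finset.single_le_sum (f := fun s => (p₁ s * W (e₁ s) (e₂ s₂) y).toReal)
    (fun _ _ => ENNReal.toReal_nonneg) (Finset.mem_univ s₁)

theorem sum_macQ₁ [Fintype Y] (s₂ : S₂) : ∑ y, macQ₁ p₁ W e₁ e₂ s₂ y = 1 := by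
  simp only [macQ₁, ENNReal.toReal_mul]
  rw [Finset.sum_comm]
  simp only [← Finset.mul_sum, PMF.sum_toReal_eq_one, mul_one]

/-- A bound on the conditional information density is a bound on the likelihood ratio,
almost surely. -/
theorem mul_toReal_le_of_macInfo₁_le {n : ℕ} (hn : 1 ≤ n) {r : ℝ} {s₁ : S₁} {s₂ : S₂} {y : Y}
    (h : macInfo₁ n p₁ W e₁ e₂ s₁ s₂ y ≤ r) :
    (p₁ s₁).toReal * (W (e₁ s₁) (e₂ s₂) y).toReal ≤
      (p₁ s₁).toReal * (macQ₁ p₁ W e₁ e₂ s₂ y * 2 ^ ((n : ℝ) * r)) := by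
  have hQ := macQ₁_nonneg p₁ W e₁ e₂ s₂ y
  have hle := mul_toReal_le_macQ₁ p₁ W e₁ e₂ s₁ s₂ y
  have hp : 0 ≤ (p₁ s₁).toReal := ENNReal.toReal_nonneg
  have hW : 0 ≤ (W (e₁ s₁) (e₂ s₂) y).toReal := ENNReal.toReal_nonneg
  rcases hp.eq_or_lt with hp0 | hp0
  · simp [← hp0]
  rcases hW.eq_or_lt with hW0 | hW0
  · rw [← hW0, mul_zero]
    positivity
  have hQ0 : 0 < macQ₁ p₁ W e₁ e₂ s₂ y := (mul_pos hp0 hW0).trans_le hle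
  have hn0 : (0 : ℝ) < n := by exact_mod_cast hn
  refine mul_le_mul_of_nonneg_left ?_ hp
  rw [macInfo₁, one_div, inv_mul_le_iff₀ hn0,
    Real.logb_le_iff_le_rpow one_lt_two (div_pos hW0 hQ0), div_le_iff₀ hQ0] at h
  rwa [mul_comm]

end

/-- Key estimate for the MAC JSCC converse: under the sphere-packing bound for the first
source, the event `{i₁(S₁,S₂,Y) ≤ R₁ − γ} ∩ {d₁(S₁, g₁(Y)) ≤ δ₁} ∩ {S₁ ∈ A₁}` has
probability at most `2^{−n(γ+k₁)}`. -/
theorem mac_jscc_converse_key_bound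
    {S₁ S₂ X₁ X₂ Y Sh₁ Sh₂ : Type*}
    [Fintype S₁] [Nonempty S₁] [Fintype S₂] [Nonempty S₂]
    [Fintype X₁] [Nonempty X₁] [Fintype X₂] [Nonempty X₂]
    [Fintype Y] [Nonempty Y] [Fintype Sh₁] [Nonempty Sh₁] [Fintype Sh₂] [Nonempty Sh₂]
    (n : ℕ) (hn : 1 ≤ n)
    (p₁ : PMF S₁) (p₂ : PMF S₂) (W : X₁ → X₂ → PMF Y)
    (e₁ : S₁ → X₁) (e₂ : S₂ → X₂) (g₁ : Y → Sh₁) (g₂ : Y → Sh₂)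
    (d₁ : S₁ → Sh₁ → ℝ) (d₂ : S₂ → Sh₂ → ℝ)
    (hd₁ : ∀ s sh, 0 ≤ d₁ s sh) (hd₂ : ∀ s sh, 0 ≤ d₂ s sh)
    (A₁ : Set S₁) (δ₁ : ℝ) (hδ₁ : 0 ≤ δ₁) (R₁ γ k₁ : ℝ)
    (hSPO₁ : ∀ sh₁ : Sh₁,
      srcPr p₁ {s₁ | s₁ ∈ A₁ ∧ d₁ s₁ sh₁ ≤ δ₁} ≤ 2 ^ (-(n : ℝ) * (R₁ + k₁))) :
    macPr p₁ p₂ W e₁ e₂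
      {z | macInfo₁ n p₁ W e₁ e₂ z.1 z.2.1 z.2.2 ≤ R₁ - γ ∧
           d₁ z.1 (g₁ z.2.2) ≤ δ₁ ∧ z.1 ∈ A₁}
      ≤ 2 ^ (-(n : ℝ) * (γ + k₁)) := by
  have hpoint : ∀ s₁ s₂ y,
      ({z | macInfo₁ n p₁ W e₁ e₂ z.1 z.2.1 z.2.2 ≤ R₁ - γ ∧
           d₁ z.1 (g₁ z.2.2) ≤ δ₁ ∧ z.1 ∈ A₁} : Set (S₁ × S₂ × Y)).indicator
        (fun z => (p₁ z.1 * p₂ z.2.1 * W (e₁ z.1) (e₂ z.2.1) z.2.2).toReal) (s₁, s₂, y) ≤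
      (p₂ s₂).toReal * (macQ₁ p₁ W e₁ e₂ s₂ y * 2 ^ ((n : ℝ) * (R₁ - γ))) *
        {s | s ∈ A₁ ∧ d₁ s (g₁ y) ≤ δ₁}.indicator (fun s => (p₁ s).toReal) s₁ := by
    intro s₁ s₂ y
    have hQ := macQ₁_nonneg p₁ W e₁ e₂ s₂ y
    refine Set.indicator_apply_le' ?_ fun _ => ?_
    · rintro ⟨hi, hd, hA⟩
      rw [Set.indicator_of_mem (show s₁ ∈ {s | s ∈ A₁ ∧ d₁ s (g₁ y) ≤ δ₁} from ⟨hA, hd⟩)]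
      simp only [ENNReal.toReal_mul]
      linarith [mul_le_mul_of_nonneg_left (mul_toReal_le_of_macInfo₁_le p₁ W e₁ e₂ hn hi)
        (ENNReal.toReal_nonneg (a := p₂ s₂))]
    · have : 0 ≤ {s | s ∈ A₁ ∧ d₁ s (g₁ y) ≤ δ₁}.indicator (fun s => (p₁ s).toReal) s₁ :=
        Set.indicator_nonneg (fun _ _ => ENNReal.toReal_nonneg) _
      positivity
  calc _ ≤ ∑ s₁, ∑ s₂, ∑ y,
        (p₂ s₂).toReal * (macQ₁ p₁ W e₁ e₂ s₂ y * 2 ^ ((n : ℝ) * (R₁ - γ))) *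
          {s | s ∈ A₁ ∧ d₁ s (g₁ y) ≤ δ₁}.indicator (fun s => (p₁ s).toReal) s₁ :=
        Finset.sum_le_sum fun s₁ _ => Finset.sum_le_sum fun s₂ _ =>
          Finset.sum_le_sum fun y _ => hpoint s₁ s₂ y
    _ = ∑ s₂, ∑ y, (p₂ s₂).toReal * (macQ₁ p₁ W e₁ e₂ s₂ y * 2 ^ ((n : ℝ) * (R₁ - γ))) *
          srcPr p₁ {s | s ∈ A₁ ∧ d₁ s (g₁ y) ≤ δ₁} := by
        rw [Finset.sum_comm]
        refine Finset.sum_congr rfl fun s₂ _ => ?_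
        rw [Finset.sum_comm]
        simp only [srcPr, Finset.mul_sum]
    _ ≤ ∑ s₂, ∑ y, (p₂ s₂).toReal * (macQ₁ p₁ W e₁ e₂ s₂ y * 2 ^ ((n : ℝ) * (R₁ - γ))) *
          2 ^ (-(n : ℝ) * (R₁ + k₁)) := by
        refine Finset.sum_le_sum fun s₂ _ => Finset.sum_le_sum fun y _ =>
          mul_le_mul_of_nonneg_left (hSPO₁ (g₁ y)) ?_
        have := macQ₁_nonneg p₁ W e₁ e₂ s₂ y
        positivity
    _ = 2 ^ ((n : ℝ) * (R₁ - γ)) * 2 ^ (-(n : ℝ) * (R₁ + k₁)) := by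
        simp only [← Finset.sum_mul, ← Finset.mul_sum, sum_macQ₁, PMF.sum_toReal_eq_one, one_mul]
    _ = 2 ^ (-(n : ℝ) * (γ + k₁)) := by
        rw [← Real.rpow_add two_pos]
        ring_nf
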